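/- For every n ≥ 0, the matching defect (acyclic) polynomial of the complete graph equals the n-th probabilist's Hermite polynomial: Σ_{k=0}^{⌊n/2⌋} (−1)^k · m_k(K_n) · X^{n−2k} = He_n(X) as polynomials with integer coefficients. -/

import Mathlib

open Finset Polynomial

/-- The probabilist's Hermite polynomials:
`He 0 = 1`, `He 1 = X`, `He (n+2) = X · He (n+1) - (n+1) · He n`. -/
noncomputable def He : ℕ → Polynomial ℤ
  | 0 => 1
  | 1 => Polynomial.X
  | (n + 2) => Polynomial.X * He (n + 1) - Polynomial.C ((n : ℤ) + 1) * He n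

/-- `matchK n k` is the number of matchings of size `k` in the complete graph on `Fin n`:
sets of `k` pairwise (vertex-)disjoint edges. -/
def matchK (n k : ℕ) : ℕ :=
  (((⊤ : SimpleGraph (Fin n)).edgeFinset.powerset.filter
    (fun A => A.card = k ∧
      ∀ e ∈ A, ∀ f ∈ A, e ≠ f → ∀ v : Fin n, ¬(v ∈ e ∧ v ∈ f))).card)

open scoped Classical in
/-- The matchings of size `k` in the complete graph on the vertices of `S`. -/
noncomputable def matchingsOn {α : Type*} [Fintype α] [DecidableEq α] (S : Finset α) (k : ℕ) :
    Finset (Finset (Sym2 α)) :=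
  univ.filter fun A => A.card = k ∧ (∀ e ∈ A, ¬e.IsDiag ∧ ∀ x ∈ e, x ∈ S) ∧
    ∀ e ∈ A, ∀ f ∈ A, e ≠ f → ∀ v : α, ¬(v ∈ e ∧ v ∈ f)

/-- The number of `k`-matchings of the complete graph on `n` vertices, by recursion. -/
def matchingCount : ℕ → ℕ → ℕ
  | _, 0 => 1
  | 0, _ + 1 => 0
  | n + 1, k + 1 => matchingCount n (k + 1) + n * matchingCount (n - 1) k

section Matchings

variable {α : Type*} [Fintype α] [DecidableEq α]

theorem mem_matchingsOn {S : Finset α} {k : ℕ} {A : Finset (Sym2 α)} :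
    A ∈ matchingsOn S k ↔ A.card = k ∧ (∀ e ∈ A, ¬e.IsDiag ∧ ∀ x ∈ e, x ∈ S) ∧
      ∀ e ∈ A, ∀ f ∈ A, e ≠ f → ∀ v : α, ¬(v ∈ e ∧ v ∈ f) := by
  simp [matchingsOn]

theorem matchingsOn_zero (S : Finset α) : matchingsOn S 0 = {∅} := by
  ext A
  simp only [mem_matchingsOn, Finset.card_eq_zero, mem_singleton]
  constructor
  · exact fun h => h.1
  · rintro rfl
    simp

theorem matchingsOn_empty_succ (k : ℕ) : matchingsOn (∅ : Finset α) (k + 1) = ∅ := by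
  ext A
  simp only [mem_matchingsOn, notMem_empty, iff_false]
  rintro ⟨hc, hS, -⟩
  obtain ⟨e, he⟩ := Finset.card_pos.mp (by omega : 0 < A.card)
  induction e with
  | h x y => exact (hS _ he).2 x (Sym2.mem_mk_left x y)

/-- Matchings either avoid the new vertex `v`, or pair it with some `u ∈ S`. -/
theorem matchingsOn_insert_succ {S : Finset α} {v : α} (hv : v ∉ S) (k : ℕ) :
    matchingsOn (insert v S) (k + 1) = matchingsOn S (k + 1) ∪
      S.biUnion fun u => (matchingsOn (S.erase u) k).image (insert s(v, u)) := by
  ext A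
  simp only [mem_union, mem_biUnion, mem_image]
  constructor
  · intro hA
    obtain ⟨hc, hS, hd⟩ := mem_matchingsOn.mp hA
    by_cases h : ∃ e ∈ A, v ∈ e
    · right
      obtain ⟨e, he, hve⟩ := h
      obtain ⟨u, rfl⟩ := hve
      have huv : u ≠ v := fun h => (hS _ he).1 (by simp [h])
      have huS : u ∈ S := by
        have := (hS _ he).2 u (Sym2.mem_mk_right v u)
        simpa [huv] using this
      refine ⟨u, huS, A.erase s(v, u), ?_, insert_erase he⟩
      refine mem_matchingsOn.mpr ⟨by rw [card_erase_of_mem he, hc]; rfl, ?_, ?_⟩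
      · intro f hf
        obtain ⟨hne, hfA⟩ := mem_erase.mp hf
        refine ⟨(hS f hfA).1, fun x hx => ?_⟩
        have hxv : x ≠ v := by
          rintro rfl
          exact hd f hfA _ he hne x ⟨hx, Sym2.mem_mk_left _ _⟩
        have hxu : x ≠ u := by
          rintro rfl
          exact hd f hfA _ he hne x ⟨hx, Sym2.mem_mk_right _ _⟩
        have := (hS f hfA).2 x hx
        simp_all
      · intro e he f hf
        exact hd e (mem_of_mem_erase he) f (mem_of_mem_erase hf)
    · left
      push Not at h
      refine mem_matchingsOn.mpr ⟨hc, fun e he => ⟨(hS e he).1, fun x hx => ?_⟩, hd⟩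
      have hxv : x ≠ v := by
        rintro rfl
        exact h e he hx
      exact (mem_insert.mp ((hS e he).2 x hx)).resolve_left hxv
  · rintro (hA | ⟨u, hu, B, hB, rfl⟩)
    · obtain ⟨hc, hS, hd⟩ := mem_matchingsOn.mp hA
      exact mem_matchingsOn.mpr
        ⟨hc, fun e he => ⟨(hS e he).1, fun x hx => mem_insert_of_mem ((hS e he).2 x hx)⟩, hd⟩
    · obtain ⟨hc, hS, hd⟩ := mem_matchingsOn.mp hB
      have huv : v ≠ u := fun h => hv (h ▸ hu)
      have hdisj : ∀ f ∈ B, ∀ x ∈ f, x ∉ s(v, u) := by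
        intro f hf x hx hx'
        have := (hS f hf).2 x hx
        rcases Sym2.mem_iff.mp hx' with rfl | rfl <;> simp_all
      have hnot : s(v, u) ∉ B := fun h =>
        hdisj _ h v (Sym2.mem_mk_left _ _) (Sym2.mem_mk_left _ _)
      refine mem_matchingsOn.mpr ⟨by rw [card_insert_of_notMem hnot, hc], ?_, ?_⟩
      · intro e he
        rcases mem_insert.mp he with rfl | he
        · refine ⟨by simpa using huv, fun x hx => ?_⟩
          rcases Sym2.mem_iff.mp hx with rfl | rfl <;> simp [hu]
        · exact ⟨(hS e he).1, fun x hx =>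
            mem_insert_of_mem (mem_of_mem_erase ((hS e he).2 x hx))⟩
      · intro e he f hf hne x hx
        rcases mem_insert.mp he with rfl | he <;> rcases mem_insert.mp hf with rfl | hf
        · exact hne rfl
        · exact hdisj f hf x hx.2 hx.1
        · exact hdisj e he x hx.1 hx.2
        · exact hd e he f hf hne x hx

theorem notMem_of_mem_matchingsOn {S : Finset α} {k : ℕ} {A : Finset (Sym2 α)}
    (hA : A ∈ matchingsOn S k) {v : α} (hv : v ∉ S) (u : α) : s(v, u) ∉ A :=
  fun h => hv (((mem_matchingsOn.mp hA).2.1 _ h).2 v (Sym2.mem_mk_left v u))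

theorem card_matchingsOn_insert_succ {S : Finset α} {v : α} (hv : v ∉ S) (k : ℕ) :
    (matchingsOn (insert v S) (k + 1)).card = (matchingsOn S (k + 1)).card +
      ∑ u ∈ S, (matchingsOn (S.erase u) k).card := by
  have hv' (u : α) : v ∉ S.erase u := fun h => hv (mem_of_mem_erase h)
  rw [matchingsOn_insert_succ hv, card_union_of_disjoint, card_biUnion]
  · congr 1
    refine sum_congr rfl fun u _ => card_image_of_injOn fun A hA B hB hAB => ?_
    have h := congrArg (fun C => C.erase s(v, u)) hAB
    simpa [erase_insert (notMem_of_mem_matchingsOn hA (hv' u) u),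
      erase_insert (notMem_of_mem_matchingsOn hB (hv' u) u)] using h
  · intro u _ w _ huw
    rw [Function.onFun_apply, disjoint_left]
    intro A hA hA'
    obtain ⟨B, hB, rfl⟩ := mem_image.mp hA
    obtain ⟨C, hC, hBC⟩ := mem_image.mp hA'
    have h : s(v, w) ∈ insert s(v, u) B := hBC ▸ mem_insert_self _ _
    rcases mem_insert.mp h with h | h
    · exact huw (Sym2.congr_right.mp h).symm
    · exact notMem_of_mem_matchingsOn hB (hv' u) w h
  · rw [disjoint_left]
    intro A hA hA'
    obtain ⟨u, -, hu⟩ := mem_biUnion.mp hA'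
    obtain ⟨B, -, rfl⟩ := mem_image.mp hu
    exact notMem_of_mem_matchingsOn hA hv u (mem_insert_self _ _)

theorem card_matchingsOn (S : Finset α) (k : ℕ) :
    (matchingsOn S k).card = matchingCount S.card k := by
  induction k generalizing S with
  | zero => simp [matchingsOn_zero, matchingCount]
  | succ k ih =>
    induction S using Finset.induction_on with
    | empty => simp [matchingsOn_empty_succ, matchingCount]
    | insert v S hv ihS =>
      rw [card_matchingsOn_insert_succ hv, ihS, card_insert_of_notMem hv, matchingCount,
        sum_congr rfl fun u hu => by rw [ih, card_erase_of_mem hu], sum_const, smul_eq_mul]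

end Matchings

theorem matchK_eq_matchingCount (n k : ℕ) : matchK n k = matchingCount n k := by
  have h := card_matchingsOn (univ : Finset (Fin n)) k
  rw [card_univ, Fintype.card_fin] at h
  rw [← h, matchK]
  congr 1
  ext A
  simp only [mem_filter, mem_powerset, mem_matchingsOn, subset_iff, SimpleGraph.mem_edgeFinset,
    SimpleGraph.edgeSet_top, mem_univ, implies_true, and_true]
  simp only [Set.mem_compl_iff, Sym2.mem_diagSet]
  tauto

theorem matchingCount_eq_zero {n k : ℕ} (h : n < 2 * k) : matchingCount n k = 0 := by
  induction k generalizing n with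
  | zero => omega
  | succ k ih =>
    induction n with
    | zero => rw [matchingCount]
    | succ n ihn =>
      rw [matchingCount, ihn (by omega)]
      rcases n with _ | n
      · simp
      · rw [ih (by omega), mul_zero, add_zero]

/-- The matching defect polynomial of the complete graph on `n` vertices, truncated to its
first `N` terms. -/
noncomputable def matchingDefectSum (n N : ℕ) : Polynomial ℤ :=
  ∑ k ∈ Finset.range N, C ((-1 : ℤ) ^ k * (matchingCount n k : ℤ)) * X ^ (n - 2 * k)

theorem matchingDefectSum_eq {n N : ℕ} (h : n / 2 + 1 ≤ N) :
    matchingDefectSum n N = matchingDefectSum n (n / 2 + 1) := by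
  refine (sum_subset (range_mono h) fun k _ hk => ?_).symm
  rw [matchingCount_eq_zero (by rw [mem_range] at hk; omega)]
  simp

theorem matchingDefectSum_add_two (n N : ℕ) :
    matchingDefectSum (n + 2) (N + 1) =
      X * matchingDefectSum (n + 1) (N + 1) - C ((n : ℤ) + 1) * matchingDefectSum n N := by
  simp only [matchingDefectSum, sum_range_succ' _ N]
  rw [mul_add X, mul_sum, mul_sum]
  rw [add_sub_right_comm, ← sum_sub_distrib]
  congr 1
  · refine sum_congr rfl fun k _ => ?_
    rw [matchingCount, Nat.add_sub_cancel, show n + 2 - 2 * (k + 1) = n - 2 * k by omega]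
    rcases Nat.lt_or_ge n (2 * k + 1) with h | h
    · rw [matchingCount_eq_zero (by omega : n + 1 < 2 * (k + 1))]
      simp [pow_succ]
      ring
    · rw [show n - 2 * k = n + 1 - 2 * (k + 1) + 1 by omega]
      simp [pow_succ]
      ring
  · simp [matchingCount, pow_succ]
    ring

theorem matchingDefectSum_eq_He (n : ℕ) : matchingDefectSum n (n / 2 + 1) = He n := by
  induction n using Nat.twoStepInduction with
  | zero => simp [matchingDefectSum, matchingCount, He]
  | one => simp [matchingDefectSum, matchingCount, He]
  | more n h₀ h₁ =>
    rw [show (n + 2) / 2 + 1 = n / 2 + 1 + 1 by omega, matchingDefectSum_add_two,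
      matchingDefectSum_eq (by omega : (n + 1) / 2 + 1 ≤ n / 2 + 1 + 1), h₀, h₁, He]

theorem matching_defect_complete_eq_hermite (n : ℕ) :
    ∑ k ∈ Finset.range (n / 2 + 1),
      Polynomial.C ((-1 : ℤ) ^ k * (matchK n k : ℤ)) * Polynomial.X ^ (n - 2 * k) = He n := by
  simp only [matchK_eq_matchingCount]
  exact matchingDefectSum_eq_He n
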